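/- arXiv:2004.09238 — 2 statements merged into one kernel-verified Lean document; each statement's English description precedes it below -/
import Mathlib

section
/- Let (β,γ) be antiferromagnetic and λ > 0; in the case x* = 1 assume additionally that β,γ ∈ (0,1) and β ≠ γ. Then for every ε₁ > 0 and ε₂ > 0 there exist R₁, R₂ ∈ S such that 0 < |R₁ − x*| < ε₁ and |R₂ − x*| < ε₂·|R₁ − x*|. -/
/-- `(β, γ)` is antiferromagnetic: both are nonnegative, `βγ < 1`, and not both are zero. -/
def Antiferro (β γ : ℝ) : Prop :=
  0 ≤ β ∧ 0 ≤ γ ∧ β * γ < 1 ∧ (β ≠ 0 ∨ γ ≠ 0)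

/-- The effective field of the pendant-triangle gadget:
`R_Δ = (1 + γλr)/(β + λr)` with `r = (β + 2λγ + λ²γ³)/(β³ + 2λβ + λ²γ)`. -/
noncomputable def triR (β γ lam : ℝ) : ℝ :=
  (1 + γ * lam * ((β + 2 * lam * γ + lam ^ 2 * γ ^ 3) / (β ^ 3 + 2 * lam * β + lam ^ 2 * γ))) /
    (β + lam * ((β + 2 * lam * γ + lam ^ 2 * γ ^ 3) / (β ^ 3 + 2 * lam * β + lam ^ 2 * γ)))

/-- The set `S` of effective fields of the field gadgets constructed in the paper: the
smallest set of reals containing `1`, containing the pendant-triangle value `R_Δ` in the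
special case `β,γ ∈ (0,1)`, `β ≠ γ`, `λ = (1−β)/(1−γ)`, and closed under the operation
`(x, y) ↦ (1 + γλxy)/(β + λxy)`. -/
inductive EffSet (β γ lam : ℝ) : ℝ → Prop where
  | one : EffSet β γ lam 1
  | tri (hβ0 : 0 < β) (hβ1 : β < 1) (hγ0 : 0 < γ) (hγ1 : γ < 1) (hβγ : β ≠ γ)
      (hlam : lam = (1 - β) / (1 - γ)) : EffSet β γ lam (triR β γ lam)
  | op {x y : ℝ} (hx : EffSet β γ lam x) (hy : EffSet β γ lam y) :
      EffSet β γ lam ((1 + γ * lam * (x * y)) / (β + lam * (x * y)))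

/-- Abstract accumulation lemma. -/
lemma accum_aux (g : ℝ → ℝ) (hc : Continuous g) (h0 : g 0 = 0) (hanti : StrictAnti g)
    (hmono : StrictMono (fun s => s + g s)) (T : Set ℝ)
    (hT : ∀ a ∈ T, ∀ b ∈ T, g (a + b) ∈ T) (a0 : ℝ) (ha0 : a0 ∈ T) (hne : a0 ≠ 0)
    (ε : ℝ) (hε : 0 < ε) : ∃ t ∈ T, t ≠ 0 ∧ |t| < ε := by
  have hcontr : ∀ s t, s ≠ t → |g s - g t| < |s - t| := by
    have key : ∀ s t, s < t → |g s - g t| < |s - t| := by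
      intro s t h
      have h1 := hanti h
      have h2 := hmono h
      simp only at h2
      rw [abs_of_pos (by linarith), abs_of_neg (by linarith)]
      linarith
    intro s t h
    rcases lt_or_gt_of_ne h with h | h
    · exact key s t h
    · rw [abs_sub_comm (g s), abs_sub_comm s]
      exact key t s h
  have hpos : ∀ s, 0 < s → g s < 0 ∧ -s < g s := by
    intro s h
    have h1 := hanti h
    have h2 := hmono h
    simp only [h0] at h1 h2
    constructor <;> linarith
  have hneg : ∀ s, s < 0 → 0 < g s ∧ g s < -s := by
    intro s h
    have h1 := hanti h
    have h2 := hmono h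
    simp only [h0] at h1 h2
    constructor <;> linarith
  have hK : ∀ a ∈ closure T, ∀ b ∈ closure T, g (a + b) ∈ closure T := by
    intro a ha b hb
    exact map_mem_closure₂ (f := fun a b => g (a + b)) (by fun_prop) ha hb
      (fun a ha b hb => hT a ha b hb)
  have hstep : ∀ a ∈ closure T, a ≠ 0 → ∃ y ∈ closure T, y ≠ 0 ∧ |y| ≤ |a| / 2 := by
    intro a ha hane
    -- an invariant interval
    obtain ⟨l, u, hal, hau, hinv⟩ : ∃ l u : ℝ, l ≤ a ∧ a ≤ u ∧
        ∀ x, l ≤ x → x ≤ u → l ≤ g (x + a) ∧ g (x + a) ≤ u := by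
      rcases lt_or_gt_of_ne hane with h | h
      · refine ⟨a, -2 * a, le_rfl, by linarith, ?_⟩
        intro x h1 h2
        rcases lt_trichotomy (x + a) 0 with h3 | h3 | h3
        · have := hneg _ h3
          constructor <;> linarith
        · rw [h3, h0]
          constructor <;> linarith
        · have := hpos _ h3
          constructor <;> linarith
      · refine ⟨-2 * a, a, by linarith, le_rfl, ?_⟩
        intro x h1 h2
        rcases lt_trichotomy (x + a) 0 with h3 | h3 | h3
        · have := hneg _ h3
          constructor <;> linarith
        · rw [h3, h0]
          constructor <;> linarith
        · have := hpos _ h3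
          constructor <;> linarith
    have hcomp : IsCompact (closure T ∩ Set.Icc l u) :=
      isCompact_Icc.inter_left isClosed_closure
    obtain ⟨y, ⟨hyK, hyl, hyu⟩, hmin⟩ := hcomp.exists_isMinOn ⟨a, ha, hal, hau⟩
      (f := fun x => |x - g (x + a)|) (by fun_prop)
    have hfix : y = g (y + a) := by
      by_contra hcon
      have hm := hmin (show g (y + a) ∈ closure T ∩ Set.Icc l u from
        ⟨hK y hyK a ha, hinv y hyl hyu⟩)
      simp only [Set.mem_setOf_eq] at hm
      have h1 := hcontr (y + a) (g (y + a) + a) (by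
        intro h
        exact hcon (by linarith))
      have h2 : y + a - (g (y + a) + a) = y - g (y + a) := by ring
      rw [h2] at h1
      linarith
    have hy0 : y ≠ 0 := by
      intro h
      rw [h, zero_add] at hfix
      exact hane (hanti.injective (by rw [h0]; exact hfix.symm))
    refine ⟨y, hyK, hy0, ?_⟩
    rcases lt_trichotomy (y + a) 0 with h3 | h3 | h3
    · have := hneg _ h3
      rw [abs_of_pos (by linarith), abs_of_neg (by linarith)]
      linarith
    · rw [h3, h0] at hfix
      exact absurd hfix hy0
    · have := hpos _ h3
      rw [abs_of_neg (by linarith), abs_of_pos (by linarith)]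
      linarith
  have hiter : ∀ n : ℕ, ∃ y ∈ closure T, y ≠ 0 ∧ |y| ≤ |a0| * (1 / 2) ^ n := by
    intro n
    induction n with
    | zero => exact ⟨a0, subset_closure ha0, hne, by simp⟩
    | succ n ih =>
      obtain ⟨y, hy, hy0, hyb⟩ := ih
      obtain ⟨z, hz, hz0, hzb⟩ := hstep y hy hy0
      refine ⟨z, hz, hz0, ?_⟩
      rw [pow_succ]
      linarith
  obtain ⟨n, hn⟩ := exists_pow_lt_of_lt_one (show 0 < ε / 2 / |a0| by positivity)
    (show (1 / 2 : ℝ) < 1 by norm_num)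
  obtain ⟨y, hy, hy0, hyb⟩ := hiter n
  have hy2 : |y| < ε / 2 := by
    refine lt_of_le_of_lt hyb ?_
    rw [lt_div_iff₀ (by positivity)] at hn
    linarith
  have hyp : 0 < |y| := abs_pos.mpr hy0
  obtain ⟨t, ht, htd⟩ := Metric.mem_closure_iff.mp hy |y| hyp
  rw [Real.dist_eq] at htd
  refine ⟨t, ht, ?_, ?_⟩
  · rintro rfl
    simp at htd
  · have h1 : |t| ≤ |y| + |y - t| := by
      have := abs_sub y (y - t)
      simpa using this
    linarith

lemma triR_pos_ne (β γ : ℝ) (hb0 : 0 < β) (hb1 : β < 1) (hg0 : 0 < γ) (hg1 : γ < 1)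
    (hne : β ≠ γ) : 0 < triR β γ ((1 - β) / (1 - γ)) ∧ triR β γ ((1 - β) / (1 - γ)) ≠ 1 := by
  have hb : 0 < 1 - β := by linarith
  have hg : 0 < 1 - γ := by linarith
  obtain ⟨l, hl⟩ : ∃ l, l = (1 - β) / (1 - γ) := ⟨_, rfl⟩
  rw [← hl]
  have hlp : 0 < l := by rw [hl]; positivity
  have hlm : l * (1 - γ) = 1 - β := by rw [hl]; field_simp
  obtain ⟨r, hr⟩ : ∃ r, r = (β + 2 * l * γ + l ^ 2 * γ ^ 3) / (β ^ 3 + 2 * l * β + l ^ 2 * γ) :=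
    ⟨_, rfl⟩
  have hrp : 0 < r := by rw [hr]; positivity
  unfold triR
  rw [← hr]
  refine ⟨by positivity, ?_⟩
  intro h
  rw [div_eq_one_iff_eq (by positivity)] at h
  have hr1 : r = 1 := by
    have : (1 - β) * (1 - r) = 0 := by
      linear_combination h + r * hlm
    rcases mul_eq_zero.mp this with h | h <;> linarith
  rw [hr1, eq_comm, div_eq_one_iff_eq (by positivity)] at hr
  have hz : (1 - β) * (1 - γ) * ((β - γ) * ((1 - β) * (1 - γ))) = 0 := by
    have e1 : (1 - γ) ^ 2 * (β - β ^ 3) + 2 * (l * (1 - γ)) * (1 - γ) * (γ - β)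
        + (l * (1 - γ)) ^ 2 * (γ ^ 3 - γ) = 0 := by
      linear_combination (1 - γ) ^ 2 * hr
    rw [hlm] at e1
    linear_combination -e1
  have hd : β - γ ≠ 0 := sub_ne_zero.mpr hne
  exact absurd hz (by positivity)

/-- `xs` is an accumulation point of the effective fields. -/
lemma effSet_accum (β γ lam xs : ℝ) (hanti : Antiferro β γ) (hlam : 0 < lam)
    (hxs : 0 < xs) (hfix : xs = (1 + γ * lam * xs ^ 2) / (β + lam * xs ^ 2))
    (hone : xs = 1 → 0 < β ∧ β < 1 ∧ 0 < γ ∧ γ < 1 ∧ β ≠ γ)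
    (ε : ℝ) (hε : 0 < ε) :
    ∃ R : ℝ, EffSet β γ lam R ∧ 0 < |R - xs| ∧ |R - xs| < ε := by
  obtain ⟨hb, hg, hbg, hn0⟩ := hanti
  -- a base element
  obtain ⟨R0, hR0, hR0p, hR0n⟩ : ∃ R, EffSet β γ lam R ∧ 0 < R ∧ R ≠ xs := by
    by_cases h1 : xs = 1
    · obtain ⟨a, b, c, d, e⟩ := hone h1
      have hl : lam = (1 - β) / (1 - γ) := by
        rw [h1, eq_comm, div_eq_one_iff_eq (by positivity)] at hfix
        rw [eq_div_iff (by linarith)]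
        linarith
      have := triR_pos_ne β γ a b c d e
      rw [← hl] at this
      exact ⟨_, EffSet.tri a b c d e hl, this.1, by rw [h1]; exact this.2⟩
    · exact ⟨1, EffSet.one, one_pos, fun h => h1 h.symm⟩
  set f : ℝ → ℝ := fun u => (1 + γ * lam * u) / (β + lam * u) with hf
  have hfpos : ∀ u, 0 < u → 0 < f u := fun u hu => by
    simp only [hf]
    positivity
  have hfanti : ∀ u v, 0 < u → u < v → f v < f u := by
    intro u v hu huv
    have hv : 0 < v := hu.trans huv
    simp only [hf]
    rw [div_lt_div_iff₀ (by positivity) (by positivity)]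
    have : 0 < lam * (v - u) * (1 - β * γ) :=
      mul_pos (mul_pos hlam (by linarith)) (by linarith)
    linarith
  have hfmono : ∀ u v, 0 < u → u < v → u * f u < v * f v := by
    intro u v hu huv
    have hv : 0 < v := hu.trans huv
    simp only [hf]
    rw [← mul_div_assoc, ← mul_div_assoc, div_lt_div_iff₀ (by positivity) (by positivity)]
    have hd : 0 < v - u := by linarith
    have : 0 < (v - u) * (β + γ * lam * β * (u + v) + γ * lam ^ 2 * u * v) := by
      apply mul_pos hd
      rcases hn0 with h | h
      · have : 0 < β := lt_of_le_of_ne hb (Ne.symm h)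
        positivity
      · have : 0 < γ := lt_of_le_of_ne hg (Ne.symm h)
        positivity
    linarith
  set g : ℝ → ℝ := fun s => Real.log (f (xs ^ 2 * Real.exp s) / xs) with hgdef
  have hup : ∀ s, 0 < xs ^ 2 * Real.exp s := fun s => by positivity
  have hgexp : ∀ s, xs * Real.exp (g s) = f (xs ^ 2 * Real.exp s) := by
    intro s
    simp only [hgdef]
    rw [Real.exp_log (div_pos (hfpos _ (hup s)) hxs)]
    field_simp
  have hgc : Continuous g := by
    simp only [hgdef, hf]
    apply Continuous.log
    · apply Continuous.div_const
      apply Continuous.div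
      · fun_prop
      · fun_prop
      · intro s
        positivity
    · intro s
      positivity
  have hg0 : g 0 = 0 := by
    simp only [hgdef, hf, Real.exp_zero, mul_one]
    rw [← hfix, div_self hxs.ne', Real.log_one]
  have hganti : StrictAnti g := by
    intro s t hst
    have h1 := hfanti _ _ (hup s) (mul_lt_mul_of_pos_left (Real.exp_lt_exp.mpr hst)
      (by positivity : 0 < xs ^ 2))
    rw [← hgexp, ← hgexp] at h1
    exact Real.exp_lt_exp.mp (lt_of_mul_lt_mul_left h1 hxs.le)
  have hgmono : StrictMono (fun s => s + g s) := by
    intro s t hst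
    have h1 := hfmono _ _ (hup s) (mul_lt_mul_of_pos_left (Real.exp_lt_exp.mpr hst)
      (by positivity : 0 < xs ^ 2))
    rw [← hgexp, ← hgexp] at h1
    apply Real.exp_lt_exp.mp
    rw [Real.exp_add, Real.exp_add]
    apply lt_of_mul_lt_mul_left _ (by positivity : 0 ≤ xs ^ 3)
    linarith
  -- continuity of `t ↦ xs * exp t` at zero
  have hcont : Continuous (fun t => xs * Real.exp t) := by fun_prop
  obtain ⟨δ, hδ, hδε⟩ := Metric.continuous_iff.mp hcont 0 ε hε
  obtain ⟨t, ht, ht0, htd⟩ := accum_aux g hgc hg0 hganti hgmono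
    {t | EffSet β γ lam (xs * Real.exp t)} (by
      intro a ha b hb
      simp only [Set.mem_setOf_eq] at ha hb ⊢
      rw [hgexp]
      have := EffSet.op ha hb
      have e : xs ^ 2 * Real.exp (a + b) = (xs * Real.exp a) * (xs * Real.exp b) := by
        rw [Real.exp_add]
        ring
      rw [e]
      exact this) (Real.log (R0 / xs)) (by
      simp only [Set.mem_setOf_eq]
      rw [Real.exp_log (by positivity), mul_div_cancel₀ _ hxs.ne']
      exact hR0) (by
      intro h
      have h2 := Real.exp_log (show 0 < R0 / xs by positivity)
      rw [h, Real.exp_zero, eq_comm, div_eq_one_iff_eq hxs.ne'] at h2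
      exact hR0n h2) δ hδ
  refine ⟨_, ht, ?_, ?_⟩
  · rw [abs_pos, sub_ne_zero]
    intro h
    apply ht0
    rw [← Real.exp_eq_one_iff]
    exact mul_left_cancel₀ hxs.ne' (by rw [h, mul_one])
  · have := hδε t (by simpa [Real.dist_eq] using htd)
    simpa [Real.dist_eq] using this

/-- Let `(β,γ)` be antiferromagnetic and `λ > 0`; if the unique positive
fixpoint `x*` of `x ↦ (1 + γλx²)/(β + λx²)` equals `1`, additionally assume `β,γ ∈ (0,1)`
and `β ≠ γ`.  Then for all `ε₁, ε₂ > 0` there exist `R₁, R₂ ∈ S` with `0 < |R₁ − x*| < ε₁`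
and `|R₂ − x*| < ε₂·|R₁ − x*|`. -/
theorem effSet_approaches_fixpoint (β γ lam xs : ℝ) (hanti : Antiferro β γ) (hlam : 0 < lam)
    (hxs : 0 < xs) (hfix : xs = (1 + γ * lam * xs ^ 2) / (β + lam * xs ^ 2))
    (hone : xs = 1 → 0 < β ∧ β < 1 ∧ 0 < γ ∧ γ < 1 ∧ β ≠ γ)
    (ε₁ ε₂ : ℝ) (hε₁ : 0 < ε₁) (hε₂ : 0 < ε₂) :
    ∃ R₁ R₂ : ℝ, EffSet β γ lam R₁ ∧ EffSet β γ lam R₂ ∧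
      0 < |R₁ - xs| ∧ |R₁ - xs| < ε₁ ∧ |R₂ - xs| < ε₂ * |R₁ - xs| := by
  obtain ⟨R₁, h1, h1p, h1e⟩ := effSet_accum β γ lam xs hanti hlam hxs hfix hone ε₁ hε₁
  obtain ⟨R₂, h2, _, h2e⟩ := effSet_accum β γ lam xs hanti hlam hxs hfix hone
    (ε₂ * |R₁ - xs|) (mul_pos hε₂ h1p)
  exact ⟨R₁, R₂, h1, h2, h1p, h1e, h2e⟩
end

section
/- Let (β,γ) be antiferromagnetic and λ > 0; in the case x* = 1 assume additionally that β,γ ∈ (0,1) and β ≠ γ. Then for every δ > 0 there exists τ₁* > 0 such that for every τ₁ ∈ (0,τ₁*) there exist τ ∈ (0,τ₁) and a finite set {R₁,…,R_k} ⊆ S ∩ [x* − τ, x* + τ] such that every x ∈ [x* − τ, x* + τ] satisfies |x − R_i| ≤ τδ for some i ∈ {1,…,k}. -/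
open Filter Topology

namespace EffAux

lemma net_lin (c : ℝ) (hc0 : 0 < c) (hc1 : c < 1) (D : Set ℝ) (h0 : (0:ℝ) ∈ D) (h1 : (1:ℝ) ∈ D)
    (hop : ∀ s ∈ D, ∀ t ∈ D, -c * (s + t) ∈ D) (ε : ℝ) (hε : 0 < ε) :
    ∃ r : ℝ, 0 < r ∧ ∀ x, |x| ≤ r → ∃ t ∈ D, |t| ≤ |x| ∧ |x - t| ≤ ε * r := by
  have hmul : ∀ N : ℕ, ∀ n : ℕ, n ≤ 2 ^ N → (n : ℝ) * (-c) ^ N ∈ D := by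
    intro N
    induction N with
    | zero =>
      intro n hn
      have : n = 0 ∨ n = 1 := by
        simp at hn; omega
      rcases this with rfl | rfl
      · simpa using h0
      · simpa using h1
    | succ N ih =>
      intro n hn
      obtain ⟨a, b, rfl, ha, hb⟩ : ∃ a b : ℕ, n = a + b ∧ a ≤ 2 ^ N ∧ b ≤ 2 ^ N := by
        refine ⟨n / 2, n - n / 2, by omega, ?_, ?_⟩ <;> (rw [pow_succ] at hn; omega)
      have := hop _ (ih a ha) _ (ih b hb)
      convert this using 1
      push_cast
      ring
  obtain ⟨N, hN⟩ : ∃ N : ℕ, 1 / (ε * c) < 2 ^ N := pow_unbounded_of_one_lt _ (by norm_num)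
  have hN' : 1 ≤ ε * c * 2 ^ N := by
    rw [div_lt_iff₀ (by positivity)] at hN
    linarith
  have hcN : 0 < c ^ N := by positivity
  have key : ∀ m : ℕ, c ^ m ≤ c ^ N → c ^ (N + 1) * 2 ^ N ≤ 2 ^ m * c ^ m →
      ∀ x : ℝ, |x| ≤ c ^ (N + 1) * 2 ^ N → 0 ≤ x * (-c) ^ m →
      ∃ t ∈ D, |t| ≤ |x| ∧ |x - t| ≤ ε * (c ^ (N + 1) * 2 ^ N) := by
    intro m hm1 hm2 x hx hsx
    have hcm : 0 < c ^ m := by positivity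
    have hne : (-c) ^ m ≠ 0 := pow_ne_zero _ (by linarith)
    have habs : |(-c) ^ m| = c ^ m := by rw [abs_pow, abs_neg, abs_of_pos hc0]
    obtain ⟨q, hq⟩ : ∃ q, x = q * (-c) ^ m := ⟨x / (-c) ^ m, by field_simp⟩
    have hq0 : 0 ≤ q := by
      rw [hq, mul_assoc] at hsx
      have : 0 < (-c) ^ m * (-c) ^ m := mul_self_pos.2 hne
      exact nonneg_of_mul_nonneg_left hsx this
    have hxq : |x| = q * c ^ m := by rw [hq, abs_mul, habs, abs_of_nonneg hq0]
    have hfl := Nat.floor_le hq0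
    have hfl2 := Nat.lt_floor_add_one q
    refine ⟨(⌊q⌋₊ : ℝ) * (-c) ^ m, hmul m _ ?_, ?_, ?_⟩
    · have : q ≤ 2 ^ m := by
        rw [hxq] at hx
        exact le_of_mul_le_mul_right (hx.trans hm2) hcm
      have h3 : ((⌊q⌋₊ : ℕ) : ℝ) ≤ ((2 ^ m : ℕ) : ℝ) := by push_cast; linarith
      exact_mod_cast h3
    · rw [abs_mul, habs, hxq, abs_of_nonneg (by positivity)]
      gcongr
    · have : x - (⌊q⌋₊ : ℝ) * (-c) ^ m = (q - ⌊q⌋₊) * (-c) ^ m := by rw [hq]; ring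
      rw [this, abs_mul, habs, abs_of_nonneg (by linarith)]
      calc (q - ⌊q⌋₊) * c ^ m ≤ 1 * c ^ N := by gcongr; linarith
        _ ≤ (ε * c * 2 ^ N) * c ^ N := by gcongr
        _ = _ := by ring
  refine ⟨c ^ (N + 1) * 2 ^ N, by positivity, fun x hx => ?_⟩
  have e1 : c ^ (N + 1) ≤ c ^ N := pow_le_pow_of_le_one hc0.le hc1.le (by omega)
  have h2N : (0:ℝ) < 2 ^ N := by positivity
  rcases le_total 0 (x * (-c) ^ N) with h | h
  · refine key N le_rfl ?_ x hx h
    nlinarith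
  · refine key (N + 1) e1 ?_ x hx ?_
    · rw [pow_succ 2 N]
      have : 0 < c ^ (N + 1) * 2 ^ N := by positivity
      nlinarith
    · rw [pow_succ]
      nlinarith

lemma min_arg (K : Set ℝ) (hK : IsClosed K) (hne : K.Nonempty) (p : ℝ)
    (h : ∀ u ∈ K, u ≠ p → ∃ u' ∈ K, |u' - p| < |u - p|) : p ∈ K := by
  obtain ⟨u, hu, hmin⟩ := hK.exists_infDist_eq_dist hne p
  by_contra hp
  have hup : u ≠ p := fun e => hp (e ▸ hu)
  obtain ⟨u', hu', hlt⟩ := h u hu hup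
  have := Metric.infDist_le_dist_of_mem (x := p) hu'
  rw [hmin, dist_comm, dist_comm p, Real.dist_eq, Real.dist_eq] at this
  linarith

/-- log coordinates argument -/
lemma accum (H : ℝ → ℝ) (hcont : Continuous H) (hanti : StrictAnti H)
    (hcontr : ∀ s t, s ≠ t → |H s - H t| < |s - t|) (a : ℝ) (ha : H (2 * a) = a)
    (S : Set ℝ) (hop : ∀ u ∈ S, ∀ v ∈ S, H (u + v) ∈ S) (b : ℝ) (hb : b ∈ S) (hba : b ≠ a) :
    a ∈ closure (S \ {a}) := by
  have hopK : ∀ u ∈ closure S, ∀ v ∈ closure S, H (u + v) ∈ closure S := by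
    intro u hu v hv
    exact map_mem_closure₂ (f := fun u v => H (u + v)) (by fun_prop) hu hv hop
  have hT1 : ∀ u ∈ closure S, u ≠ a → u ∈ closure (S \ {a}) := by
    intro u hu hua
    rw [mem_closure_iff_nhds] at hu ⊢
    intro t ht
    obtain ⟨z, hz, hzS⟩ := hu (t ∩ {a}ᶜ) (inter_mem ht (isOpen_compl_singleton.mem_nhds hua))
    exact ⟨z, hz.1, ⟨hzS, hz.2⟩⟩
  refine min_arg _ isClosed_closure ⟨b, subset_closure (show b ∈ S \ {a} from ⟨hb, hba⟩)⟩ a ?_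
  intro v hv hva
  have hvK : v ∈ closure S := closure_mono Set.sdiff_subset hv
  have hcp : ∃ p, p = H (p + v) ∧ |p - a| < |v - a| ∧ p ≠ a := by
    have hpa : ∀ p, p = H (p + v) → p ≠ a := by
      rintro p hp rfl
      have : H (2 * p) = H (p + v) := by rw [ha, ← hp]
      have := hanti.injective this
      apply hva; linarith
    have hc : Continuous (fun u => u - H (u + v)) := by fun_prop
    have hpb : ∀ p, p = H (p + v) → p ≠ 2 * a - v := by
      rintro p hp h
      rw [h] at hp
      have : 2 * a - v + v = 2 * a := by ring
      rw [this, ha] at hp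
      apply hva; linarith
    have e1 : 2 * a - v + v = 2 * a := by ring
    rcases lt_or_gt_of_ne hva with h | h
    · have h2 : H (2 * a) < H (a + v) := hanti (by linarith)
      obtain ⟨p, hp, hp2⟩ := intermediate_value_Icc (a := a) (b := 2 * a - v) (by linarith)
        hc.continuousOn (show (0:ℝ) ∈ _ from ⟨by linarith, by simp only [e1, ha]; linarith⟩)
      have hp3 : p = H (p + v) := by simp only at hp2; linarith
      have q1 := lt_of_le_of_ne hp.1 (hpa p hp3).symm
      have q2 := lt_of_le_of_ne hp.2 (hpb p hp3)
      refine ⟨p, hp3, ?_, hpa p hp3⟩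
      rw [abs_of_pos (by linarith), abs_of_neg (by linarith)]
      linarith
    · have h2 : H (a + v) < H (2 * a) := hanti (by linarith)
      obtain ⟨p, hp, hp2⟩ := intermediate_value_Icc (a := 2 * a - v) (b := a) (by linarith)
        hc.continuousOn (show (0:ℝ) ∈ _ from ⟨by simp only [e1, ha]; linarith, by linarith⟩)
      have hp3 : p = H (p + v) := by simp only at hp2; linarith
      have q1 := lt_of_le_of_ne hp.2 (hpa p hp3)
      have q2 := lt_of_le_of_ne hp.1 (hpb p hp3).symm
      refine ⟨p, hp3, ?_, hpa p hp3⟩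
      rw [abs_of_neg (by linarith), abs_of_pos (by linarith)]
      linarith
  obtain ⟨p, hp, hlt, hpa⟩ := hcp
  refine ⟨p, hT1 p ?_ hpa, hlt⟩
  refine min_arg _ isClosed_closure ⟨b, subset_closure hb⟩ p ?_
  intro u hu hup
  refine ⟨H (u + v), hopK u hu v hvK, ?_⟩
  have := hcontr (u + v) (p + v) (by simpa using hup)
  rw [← hp] at this
  simpa using this

lemma effSet_pos {β γ lam : ℝ} (hβ : 0 ≤ β) (hγ : 0 ≤ γ) (hlam : 0 < lam) {x : ℝ}
    (h : EffSet β γ lam x) : 0 < x := by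
  induction h with
  | one => exact one_pos
  | tri h1 h2 h3 h4 h5 h6 => unfold triR; positivity
  | op hx hy ihx ihy => positivity

lemma triR_ne_one {β γ : ℝ} (h1 : 0 < β) (h2 : β < 1) (h3 : 0 < γ) (h4 : γ < 1) (h5 : β ≠ γ)
    {lam : ℝ} (hl : 0 < lam) (hlam : lam * (1 - γ) = 1 - β) : triR β γ lam ≠ 1 := by
  unfold triR
  set A := β + 2 * lam * γ + lam ^ 2 * γ ^ 3 with hA
  set B := β ^ 3 + 2 * lam * β + lam ^ 2 * γ with hB
  have hA0 : 0 < A := by positivity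
  have hB0 : 0 < B := by positivity
  intro h
  rw [div_eq_one_iff_eq (by positivity)] at h
  have hr : lam * (1 - γ) * (A / B) = 1 - β := by linarith
  rw [hlam] at hr
  have hr1 : A / B = 1 := by
    have : (1 - β) * (A / B - 1) = 0 := by linarith
    rcases mul_eq_zero.1 this with h | h <;> linarith
  have hAB : A = B := by rwa [div_eq_one_iff_eq hB0.ne'] at hr1
  have hl' : lam = (1 - β) / (1 - γ) := by rw [eq_div_iff (by linarith)]; exact hlam
  have hg : (1 - γ) ≠ 0 := by linarith
  have hid : (A - B) * (1 - γ) ^ 2 = (1 - β) ^ 2 * (1 - γ) ^ 2 * (γ - β) := by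
    rw [hA, hB, hl']; field_simp; ring
  rw [hAB, sub_self, zero_mul] at hid
  have : (1 - β) ^ 2 * (1 - γ) ^ 2 * (γ - β) ≠ 0 := by
    refine mul_ne_zero (mul_ne_zero (pow_ne_zero _ (by linarith)) (pow_ne_zero _ hg)) ?_
    exact sub_ne_zero.2 h5.symm
  exact this hid.symm

lemma effSet_accum (β γ lam xs : ℝ) (hanti : Antiferro β γ) (hlam : 0 < lam)
    (hxs : 0 < xs) (hfix : xs = (1 + γ * lam * xs ^ 2) / (β + lam * xs ^ 2))
    (hone : xs = 1 → 0 < β ∧ β < 1 ∧ 0 < γ ∧ γ < 1 ∧ β ≠ γ) :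
    xs ∈ closure ({x | EffSet β γ lam x} \ {xs}) := by
  obtain ⟨hβ, hγ, hβγ, hne⟩ := hanti
  have hstart : ∃ b, EffSet β γ lam b ∧ b ≠ xs := by
    by_cases h1 : xs = 1
    · obtain ⟨k1, k2, k3, k4, k5⟩ := hone h1
      subst h1
      have hl : lam * (1 - γ) = 1 - β := by
        rw [eq_div_iff (by positivity)] at hfix
        linarith
      exact ⟨_, .tri k1 k2 k3 k4 k5 (by rw [eq_div_iff (by linarith)]; exact hl),
        triR_ne_one k1 k2 k3 k4 k5 hlam hl⟩
    · exact ⟨1, .one, fun h => h1 h.symm⟩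
  obtain ⟨b, hb, hbx⟩ := hstart
  have hbpos := effSet_pos hβ hγ hlam hb
  let H : ℝ → ℝ := fun s => Real.log ((1 + γ * lam * Real.exp s) / (β + lam * Real.exp s))
  have hnum : ∀ s, 0 < 1 + γ * lam * Real.exp s := fun s => by positivity
  have hden : ∀ s, 0 < β + lam * Real.exp s := fun s => by positivity
  have hcont : Continuous H := by
    refine Continuous.log (Continuous.div (by fun_prop) (by fun_prop) fun s => (hden s).ne') ?_
    exact fun s => (div_pos (hnum s) (hden s)).ne'
  have hAnti : StrictAnti H := by
    intro s t hst
    refine Real.log_lt_log (div_pos (hnum t) (hden t)) ?_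
    rw [div_lt_div_iff₀ (hden t) (hden s)]
    have he := Real.exp_lt_exp.2 hst
    have : 0 < lam * (1 - β * γ) * (Real.exp t - Real.exp s) :=
      mul_pos (mul_pos hlam (by linarith)) (by linarith)
    nlinarith
  have hc1 : ∀ s t, s < t → H s - H t < t - s := by
    intro s t hst
    have he := Real.exp_lt_exp.2 hst
    have hs0 := Real.exp_pos s
    have ht0 := Real.exp_pos t
    have : H s + s < H t + t := by
      have e : ∀ s, H s + s =
          Real.log ((1 + γ * lam * Real.exp s) / (β + lam * Real.exp s) * Real.exp s) := by
        intro s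
        rw [Real.log_mul (div_pos (hnum s) (hden s)).ne' (Real.exp_pos s).ne', Real.log_exp]
      rw [e, e]
      refine Real.log_lt_log (mul_pos (div_pos (hnum s) (hden s)) hs0) ?_
      rw [div_mul_eq_mul_div, div_mul_eq_mul_div, div_lt_div_iff₀ (hden s) (hden t)]
      generalize Real.exp s = p at *
      generalize Real.exp t = q at *
      have e2 : (1 + γ * lam * q) * q * (β + lam * p) - (1 + γ * lam * p) * p * (β + lam * q)
        = (q - p) * (β + β * γ * lam * (p + q) + γ * lam ^ 2 * p * q) := by ring
      have : 0 < β + β * γ * lam * (p + q) + γ * lam ^ 2 * p * q := by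
        rcases hne with h | h
        · have := lt_of_le_of_ne hβ h.symm
          positivity
        · have := lt_of_le_of_ne hγ h.symm
          positivity
      have := mul_pos (sub_pos.2 he) this
      linarith
    linarith
  have hcontr : ∀ s t, s ≠ t → |H s - H t| < |s - t| := by
    have w : ∀ s t, s < t → |H s - H t| < |s - t| := by
      intro s t hst
      rw [abs_of_pos (sub_pos.2 (hAnti hst)), abs_of_neg (by linarith)]
      linarith [hc1 s t hst]
    intro s t hst
    rcases lt_or_gt_of_ne hst with h | h
    · exact w s t h
    · rw [abs_sub_comm, abs_sub_comm s]; exact w t s h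
  have hmem := accum H hcont hAnti hcontr (Real.log xs)
    (by
      have : Real.exp (2 * Real.log xs) = xs ^ 2 := by
        rw [two_mul, Real.exp_add, Real.exp_log hxs, sq]
      simp only [H, this]
      rw [← hfix])
    {y | EffSet β γ lam (Real.exp y)}
    (by
      intro u hu v hv
      simp only [Set.mem_setOf_eq, H]
      rw [Real.exp_log (div_pos (hnum _) (hden _)), Real.exp_add]
      exact .op hu hv)
    (Real.log b) (by simpa [Real.exp_log hbpos] using hb)
    (by
      intro h
      exact hbx (Real.log_injOn_pos hbpos hxs h))
  have := map_mem_closure Real.continuous_exp hmem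
    (t := {x | EffSet β γ lam x} \ {xs}) (by
      rintro y ⟨hy, hy2⟩
      refine ⟨hy, ?_⟩
      intro h
      apply hy2
      simp only [Set.mem_singleton_iff] at h ⊢
      rw [← h, Real.log_exp])
  rwa [Real.exp_log hxs] at this

end EffAux

/-- Let `(β,γ)` be antiferromagnetic and `λ > 0`; if the unique positive
fixpoint `x*` of `x ↦ (1 + γλx²)/(β + λx²)` equals `1`, additionally assume `β,γ ∈ (0,1)`
and `β ≠ γ`.  Then for every `δ > 0` there is `τ₁* > 0` such that for every `τ₁ ∈ (0,τ₁*)`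
there exist `τ ∈ (0,τ₁)` and a finite set `{R₁,…,R_k} ⊆ S ∩ [x*−τ, x*+τ]` such that every
`x ∈ [x*−τ, x*+τ]` satisfies `|x − Rᵢ| ≤ τδ` for some `i`. -/
theorem effSet_dense_family (β γ lam xs : ℝ) (hanti : Antiferro β γ) (hlam : 0 < lam)
    (hxs : 0 < xs) (hfix : xs = (1 + γ * lam * xs ^ 2) / (β + lam * xs ^ 2))
    (hone : xs = 1 → 0 < β ∧ β < 1 ∧ 0 < γ ∧ γ < 1 ∧ β ≠ γ)
    (δ : ℝ) (hδ : 0 < δ) :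
    ∃ τ₁s : ℝ, 0 < τ₁s ∧ ∀ τ₁ ∈ Set.Ioo 0 τ₁s, ∃ τ ∈ Set.Ioo (0 : ℝ) τ₁,
      ∃ (k : ℕ) (R : Fin k → ℝ),
        (∀ i, EffSet β γ lam (R i) ∧ R i ∈ Set.Icc (xs - τ) (xs + τ)) ∧
        ∀ x ∈ Set.Icc (xs - τ) (xs + τ), ∃ i, |x - R i| ≤ τ * δ := by
  classical
  have hacc := EffAux.effSet_accum β γ lam xs hanti hlam hxs hfix hone
  have hS := hanti
  obtain ⟨hβ, hγ, hβγ, hne⟩ := hanti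
  set l := 𝓝[{x | EffSet β γ lam x} \ {xs}] xs with hl
  haveI hbot : l.NeBot := mem_closure_iff_nhdsWithin_neBot.1 hacc
  have hlne : ∀ᶠ x in l, EffSet β γ lam x ∧ x ≠ xs := by
    filter_upwards [self_mem_nhdsWithin] with x hx
    exact ⟨hx.1, hx.2⟩
  have hlx : Tendsto (fun x : ℝ => x) l (𝓝 xs) := tendsto_id.mono_left nhdsWithin_le_nhds
  have hl0 : Tendsto (fun x : ℝ => x - xs) l (𝓝 0) := by
    simpa using hlx.sub_const xs
  have hden : 0 < β + lam * xs ^ 2 := by positivity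
  have hfix' : xs * (β + lam * xs ^ 2) = 1 + γ * lam * xs ^ 2 := by
    rwa [eq_div_iff hden.ne'] at hfix
  set c : ℝ := lam * (1 - β * γ) * xs / (β + lam * xs ^ 2) ^ 2 with hc
  have hc0 : 0 < c := by
    have : 0 < 1 - β * γ := by linarith
    positivity
  have hc1 : c < 1 := by
    rw [hc, div_lt_one (by positivity)]
    have h1 : 0 < β + 2 * β * γ * lam * xs ^ 2 + γ * lam ^ 2 * xs ^ 4 := by
      rcases hne with h | h
      · have := lt_of_le_of_ne hβ h.symm
        positivity
      · have := lt_of_le_of_ne hγ h.symm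
        positivity
    have h2 : xs * (lam * (1 - β * γ) * xs) < xs * (β + lam * xs ^ 2) ^ 2 := by
      have : xs * (β + lam * xs ^ 2) ^ 2 = (1 + γ * lam * xs ^ 2) * (β + lam * xs ^ 2) := by
        rw [← hfix']; ring
      rw [this]
      nlinarith
    exact lt_of_mul_lt_mul_left h2 hxs.le
  let D : Set ℝ := {t | ∃ k : ℝ → ℝ, (∀ᶠ x in l, EffSet β γ lam (k x)) ∧
    Tendsto (fun x => (k x - xs) / (x - xs)) l (𝓝 t)}
  have hD1 : (1 : ℝ) ∈ D := by
    refine ⟨fun x => x, hlne.mono fun x hx => hx.1, ?_⟩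
    refine tendsto_const_nhds.congr' ?_
    filter_upwards [hlne] with x hx
    rw [div_self (sub_ne_zero.2 hx.2)]
  have hD0 : (0 : ℝ) ∈ D := by
    have hex : ∀ x : ℝ, x ≠ xs → ∃ s, EffSet β γ lam s ∧ |s - xs| < (x - xs) ^ 2 := by
      intro x hx
      have hp : 0 < (x - xs) ^ 2 := by
        have := sub_ne_zero.2 hx
        positivity
      obtain ⟨s, hs, hd⟩ := Metric.mem_closure_iff.1 hacc _ hp
      refine ⟨s, hs.1, ?_⟩
      rwa [dist_comm, Real.dist_eq] at hd
    choose! k hk1 hk2 using hex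
    refine ⟨k, hlne.mono fun x hx => hk1 x hx.2, ?_⟩
    refine squeeze_zero_norm' (a := fun x => |x - xs|) ?_ (by simpa using hl0.abs)
    filter_upwards [hlne] with x hx
    have hp : 0 < |x - xs| := abs_pos.2 (sub_ne_zero.2 hx.2)
    rw [Real.norm_eq_abs, abs_div, div_le_iff₀ hp, ← sq, sq_abs]
    exact (hk2 x hx.2).le
  have hDop : ∀ s ∈ D, ∀ t ∈ D, -c * (s + t) ∈ D := by
    have hlim : ∀ k : ℝ → ℝ, ∀ t, Tendsto (fun x => (k x - xs) / (x - xs)) l (𝓝 t) →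
        Tendsto k l (𝓝 xs) := by
      intro k t hk
      have h1 := (hk.mul hl0).add_const xs
      simp only [mul_zero, zero_add] at h1
      refine h1.congr' ?_
      filter_upwards [hlne] with x hx
      rw [div_mul_cancel₀ _ (sub_ne_zero.2 hx.2)]
      ring
    rintro s ⟨k, hk, hks⟩ t ⟨j, hj, hjt⟩
    have hk' := hlim k s hks
    have hj' := hlim j t hjt
    refine ⟨fun x => (1 + γ * lam * (k x * j x)) / (β + lam * (k x * j x)), ?_, ?_⟩
    · filter_upwards [hk, hj] with x h1 h2
      exact .op h1 h2
    · have hd : Tendsto (fun x => lam * (β * γ - 1) /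
          ((β + lam * (k x * j x)) * (β + lam * xs ^ 2)) *
          (j x * ((k x - xs) / (x - xs)) + xs * ((j x - xs) / (x - xs)))) l
          (𝓝 (lam * (β * γ - 1) / ((β + lam * (xs * xs)) * (β + lam * xs ^ 2)) *
            (xs * s + xs * t))) := by
        refine Tendsto.mul (Tendsto.div tendsto_const_nhds ?_ (by positivity)) ?_
        · exact ((((hk'.mul hj').const_mul lam).const_add β).mul_const _)
        · exact (hj'.mul hks).add (hjt.const_mul xs)
      have e : lam * (β * γ - 1) / ((β + lam * (xs * xs)) * (β + lam * xs ^ 2)) *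
            (xs * s + xs * t) = -c * (s + t) := by
        rw [hc, ← sq xs]
        field_simp
        ring
      rw [e] at hd
      refine hd.congr' ?_
      filter_upwards [hk, hj, hlne] with x h1 h2 hx
      have p1 := EffAux.effSet_pos hβ hγ hlam h1
      have p2 := EffAux.effSet_pos hβ hγ hlam h2
      have hq : 0 < β + lam * (k x * j x) := by positivity
      have hxx : x - xs ≠ 0 := sub_ne_zero.2 hx.2
      have hE : (1 + γ * lam * (k x * j x)) / (β + lam * (k x * j x)) - xs =
          lam * (β * γ - 1) / ((β + lam * (k x * j x)) * (β + lam * xs ^ 2)) *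
            (k x * j x - xs ^ 2) := by
        have hfx : xs = (1 + γ * lam * xs ^ 2) / (β + lam * xs ^ 2) := hfix
        generalize k x * j x = q at *
        have : (1 + γ * lam * q) / (β + lam * q) - (1 + γ * lam * xs ^ 2) / (β + lam * xs ^ 2)
          = lam * (β * γ - 1) / ((β + lam * q) * (β + lam * xs ^ 2)) * (q - xs ^ 2) := by
          field_simp
          ring
        rw [← this, ← hfx]
      rw [hE]
      field_simp
      ring
  -- assembly
  set η : ℝ := min δ 1 / 4 with hη
  have hm0 : 0 < min δ 1 := lt_min hδ one_pos
  have hη0 : 0 < η := by positivity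
  have hη1 : η ≤ 1 / 4 := by
    have := min_le_right δ 1
    rw [hη]; linarith
  have hηδ : 4 * η ≤ δ := by
    have := min_le_left δ 1
    rw [hη]; linarith
  obtain ⟨r, hr, hnet⟩ := EffAux.net_lin c hc0 hc1 D hD0 hD1 hDop η hη0
  have hηr : 0 < η * r := by positivity
  obtain ⟨P, hPsub, hPfin, hPcov⟩ :=
    (isCompact_Icc (a := -r) (b := r)).finite_cover_balls hηr
  have hex : ∀ p ∈ P, ∃ k : ℝ → ℝ, ∀ᶠ x in l, EffSet β γ lam (k x) ∧
      |(k x - xs) / (x - xs)| ≤ r ∧ |p - (k x - xs) / (x - xs)| ≤ 3 * (η * r) := by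
    intro p hp
    have hpr : |p| ≤ r := abs_le.2 (hPsub hp)
    have hp1 : |p * (1 - η)| = |p| * (1 - η) := by
      rw [abs_mul, abs_of_nonneg (a := 1 - η) (by linarith)]
    have hp2 : |p| * (1 - η) ≤ r * (1 - η) := by
      have : 0 ≤ 1 - η := by linarith
      gcongr
    obtain ⟨t, ⟨k, hk, hkt⟩, ht1, ht2⟩ := hnet (p * (1 - η)) (by rw [hp1]; nlinarith)
    refine ⟨k, ?_⟩
    have := Metric.tendsto_nhds.1 hkt _ hηr
    filter_upwards [hk, this] with x h1 h2
    rw [Real.dist_eq] at h2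
    rw [hp1] at ht1
    have hpη : |p * η| ≤ η * r := by
      rw [abs_mul, abs_of_pos hη0, mul_comm]
      gcongr
    have a1 := abs_lt.1 h2
    have a2 := abs_le.1 (ht1.trans hp2)
    have a3 := abs_le.1 ht2
    have a4 := abs_le.1 hpη
    refine ⟨h1, abs_le.2 ⟨by nlinarith, by nlinarith⟩, abs_le.2 ⟨by nlinarith, by nlinarith⟩⟩
  choose! k hk using hex
  refine ⟨1, one_pos, fun τ₁ hτ₁ => ?_⟩
  have hall : ∀ᶠ x in l, ∀ p ∈ P, EffSet β γ lam (k p x) ∧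
      |(k p x - xs) / (x - xs)| ≤ r ∧ |p - (k p x - xs) / (x - xs)| ≤ 3 * (η * r) :=
    (eventually_all_finite hPfin).2 hk
  have hsm : ∀ᶠ x in l, |x - xs| < τ₁ / r := by
    have h := Metric.tendsto_nhds.1 hlx _ (div_pos hτ₁.1 hr)
    simpa [Real.dist_eq] using h
  obtain ⟨w, hw1, hw2, hw3⟩ := (hall.and (hsm.and hlne)).exists
  have hw0 : 0 < |w - xs| := abs_pos.2 (sub_ne_zero.2 hw3.2)
  have hwne := sub_ne_zero.2 hw3.2
  refine ⟨r * |w - xs|, ⟨by positivity, ?_⟩, hPfin.toFinset.card,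
    fun i => k (hPfin.toFinset.equivFin.symm i) w, ?_, ?_⟩
  · rw [lt_div_iff₀ hr] at hw2
    linarith
  · intro i
    have hi := hw1 _ (hPfin.mem_toFinset.1 (hPfin.toFinset.equivFin.symm i).2)
    refine ⟨hi.1, ?_⟩
    have h2 := hi.2.1
    rw [abs_div, div_le_iff₀ hw0, abs_le] at h2
    exact ⟨by linarith [h2.1], by linarith [h2.2]⟩
  · intro y hy
    have hz : |(y - xs) / (w - xs)| ≤ r := by
      rw [abs_div, div_le_iff₀ hw0, abs_le]
      exact ⟨by linarith [hy.1], by linarith [hy.2]⟩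
    have hcov := hPcov (abs_le.1 hz)
    simp only [Set.mem_iUnion, Metric.mem_ball, Real.dist_eq] at hcov
    obtain ⟨p, hp, hzp⟩ := hcov
    refine ⟨hPfin.toFinset.equivFin ⟨p, hPfin.mem_toFinset.2 hp⟩, ?_⟩
    simp only [Equiv.symm_apply_apply]
    have h3 := (hw1 p hp).2.2
    have e : y - k p w = ((y - xs) / (w - xs) - p + (p - (k p w - xs) / (w - xs))) * (w - xs) := by
      field_simp
      ring
    rw [e, abs_mul]
    have h4 := abs_add_le ((y - xs) / (w - xs) - p) (p - (k p w - xs) / (w - xs))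
    have h5 : |(y - xs) / (w - xs) - p + (p - (k p w - xs) / (w - xs))| ≤ r * δ := by
      have h6 : r * (4 * η) ≤ r * δ := mul_le_mul_of_nonneg_left hηδ hr.le
      linarith
    calc _ ≤ r * δ * |w - xs| := by gcongr
      _ = _ := by ring
end
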